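/- arXiv:1704.05194 — 3 statements merged into one kernel-verified Lean document; each statement's English description precedes it below -/
import Mathlib

section
/- Let d, k be positive natural numbers, let loss : ℝ^(d×k) → ℝ be differentiable at Θ ∈ ℝ^(d×k), and let λ, β ≥ 0. Define f(Θ) = loss(Θ) + λ‖Θ‖₂,₁ + β‖Θ‖₁. Then for every D ∈ ℝ^(d×k), the one-sided directional derivative f'(Θ;D) = lim_{α→0⁺} (f(Θ+αD) − f(Θ))/α exists and equals ⟨∇loss(Θ), D⟩ + λ·(Σ_{i : Θᵢ· ≠ 0} ⟨Θᵢ·, Dᵢ·⟩/‖Θᵢ·‖₂ + Σ_{i : Θᵢ· = 0} ‖Dᵢ·‖₂) + β·(Σ_{(i,j) : Θᵢⱼ ≠ 0} sign(Θᵢⱼ)·Dᵢⱼ + Σ_{(i,j) : Θᵢⱼ = 0} |Dᵢⱼ|). -/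
open Filter
open scoped Topology

/-- One-sided derivative of the absolute value along a line. -/
lemma hasDerivWithinAt_abs_add_mul (x v : ℝ) :
    HasDerivWithinAt (fun α : ℝ => |x + α * v|)
      ((if x ≠ 0 then Real.sign x * v else 0) + if x = 0 then |v| else 0) (Set.Ioi 0) 0 := by
  have hline : HasDerivAt (fun α : ℝ => x + α * v) v 0 := by
    simpa using ((hasDerivAt_id (0 : ℝ)).mul_const v).const_add x
  rcases lt_trichotomy x 0 with hx | rfl | hx
  · have h := (hasDerivAt_abs_neg (x := x + 0 * v) (by simpa using hx)).comp 0 hline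
    simpa [Function.comp_def, hx.ne, Real.sign_of_neg hx] using h.hasDerivWithinAt
  · have h : HasDerivWithinAt (fun α : ℝ => α * |v|) |v| (Set.Ioi 0) 0 := by
      simpa using ((hasDerivAt_id (0 : ℝ)).mul_const |v|).hasDerivWithinAt
    simp only [ne_eq, not_true_eq_false, if_false, if_true, zero_add]
    refine h.congr (fun α hα => ?_) (by simp)
    rw [abs_mul, abs_of_pos (Set.mem_Ioi.mp hα)]
  · have h := (hasDerivAt_abs_pos (x := x + 0 * v) (by simpa using hx)).comp 0 hline
    simpa [Function.comp_def, hx.ne', Real.sign_of_pos hx] using h.hasDerivWithinAt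

open Classical in
/-- One-sided derivative of the Euclidean norm along a line. -/
lemma hasDerivWithinAt_sqrt_sum_sq_add_mul {ι : Type*} [Fintype ι] (x v : ι → ℝ) :
    HasDerivWithinAt (fun α : ℝ => Real.sqrt (∑ j, (x j + α * v j) ^ 2))
      ((if x ≠ 0 then (∑ j, x j * v j) / Real.sqrt (∑ j, x j ^ 2) else 0) +
        if x = 0 then Real.sqrt (∑ j, v j ^ 2) else 0) (Set.Ioi 0) 0 := by
  by_cases hx : x = 0
  · subst hx
    have h : HasDerivWithinAt (fun α : ℝ => α * Real.sqrt (∑ j, v j ^ 2))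
        (Real.sqrt (∑ j, v j ^ 2)) (Set.Ioi 0) 0 := by
      simpa using
        ((hasDerivAt_id (0 : ℝ)).mul_const (Real.sqrt (∑ j, v j ^ 2))).hasDerivWithinAt
    simp only [ne_eq, not_true_eq_false, if_false, if_true, zero_add, Pi.zero_apply]
    refine h.congr (fun α hα => ?_) (by simp)
    simp only [mul_pow]
    rw [← Finset.mul_sum, Real.sqrt_mul (sq_nonneg α), Real.sqrt_sq (Set.mem_Ioi.mp hα).le]
  · have hne : ∑ j, x j ^ 2 ≠ 0 := by
      rw [Ne, Finset.sum_eq_zero_iff_of_nonneg fun j _ => sq_nonneg (x j)]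
      exact fun h => hx (funext fun j => pow_eq_zero_iff two_ne_zero |>.mp (h j (Finset.mem_univ j)))
    have hsum : HasDerivAt (fun α : ℝ => ∑ j, (x j + α * v j) ^ 2)
        (∑ j, 2 * (x j * v j)) 0 := by
      refine HasDerivAt.fun_sum fun j _ => ?_
      have hline : HasDerivAt (fun α : ℝ => x j + α * v j) (v j) 0 := by
        simpa using ((hasDerivAt_id (0 : ℝ)).mul_const (v j)).const_add (x j)
      simpa [mul_assoc] using hline.fun_pow 2
    have h := hsum.sqrt (by simpa using hne)
    rw [← Finset.mul_sum] at h
    simp only [zero_mul, add_zero] at h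
    rw [mul_div_mul_left _ _ two_ne_zero] at h
    simpa [hx] using h.hasDerivWithinAt

open Classical in
/-- The explicit formula for the one-sided directional derivative `f'(Θ;D)` of
`f(Θ) = loss(Θ) + λ‖Θ‖₂,₁ + β‖Θ‖₁`, combining Equations (14), (16) and (17)
in the proof of Lemma 2.1. -/
theorem directional_derivative_formula
    (d k : ℕ) (hd : 0 < d) (hk : 0 < k)
    (loss : (Fin d → Fin k → ℝ) → ℝ) (Θ : Fin d → Fin k → ℝ)
    (hloss : DifferentiableAt ℝ loss Θ)
    (lam β : ℝ) (hlam : 0 ≤ lam) (hβ : 0 ≤ β)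
    (D : Fin d → Fin k → ℝ) :
    let f : (Fin d → Fin k → ℝ) → ℝ := fun T =>
      loss T + lam * (∑ i, Real.sqrt (∑ j, T i j ^ 2)) + β * ∑ i, ∑ j, |T i j|
    Tendsto (fun α : ℝ => (f (Θ + α • D) - f Θ) / α) (𝓝[>] 0)
      (𝓝 (fderiv ℝ loss Θ D
        + lam * ((∑ i ∈ Finset.univ.filter fun i => Θ i ≠ 0,
              (∑ j, Θ i j * D i j) / Real.sqrt (∑ j, Θ i j ^ 2))
          + ∑ i ∈ Finset.univ.filter fun i => Θ i = 0,
              Real.sqrt (∑ j, D i j ^ 2))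
        + β * ((∑ p ∈ Finset.univ.filter fun p : Fin d × Fin k => Θ p.1 p.2 ≠ 0,
              Real.sign (Θ p.1 p.2) * D p.1 p.2)
          + ∑ p ∈ Finset.univ.filter fun p : Fin d × Fin k => Θ p.1 p.2 = 0,
              |D p.1 p.2|))) := by
  intro f
  have hl : HasDerivWithinAt (fun α : ℝ => loss (Θ + α • D)) (fderiv ℝ loss Θ D)
      (Set.Ioi 0) 0 := by
    have hline : HasDerivAt (fun α : ℝ => Θ + α • D) D 0 := by
      simpa using ((hasDerivAt_id (0 : ℝ)).smul_const D).const_add Θ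
    have hloss' : HasFDerivAt loss (fderiv ℝ loss Θ) (Θ + (0 : ℝ) • D) := by
      simpa using hloss.hasFDerivAt
    exact (hloss'.comp_hasDerivAt 0 hline).hasDerivWithinAt
  have hrows := HasDerivWithinAt.fun_sum (u := Finset.univ)
    fun i _ => hasDerivWithinAt_sqrt_sum_sq_add_mul (Θ i) (D i)
  have hentries := HasDerivWithinAt.fun_sum (u := Finset.univ)
    fun (p : Fin d × Fin k) _ => hasDerivWithinAt_abs_add_mul (Θ p.1 p.2) (D p.1 p.2)
  have h := (hl.fun_add (hrows.const_mul lam)).fun_add (hentries.const_mul β)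
  rw [Finset.sum_add_distrib, Finset.sum_add_distrib] at h
  simp only [← Finset.sum_filter] at h
  rw [hasDerivWithinAt_iff_tendsto_slope' (by simp)] at h
  convert h using 2 with α
  simp [f, slope_def_field, Fintype.sum_prod_type]
end

section
/- Let k be a positive natural number, let g, θ ∈ ℝ^k with θ ≠ 0, and let λ, β ≥ 0, μ > 0. Define sⱼ = −gⱼ − λ·θⱼ/‖θ‖₂ for each j, and define φ : ℝ^k → ℝ by φ(D) = ⟨g, D⟩ + λ·⟨θ, D⟩/‖θ‖₂ + β·(Σ_{j : θⱼ ≠ 0} sign(θⱼ)·Dⱼ + Σ_{j : θⱼ = 0} |Dⱼ|) + μ‖D‖₂². Then φ attains a strict global minimum at the unique point D* given coordinatewise by D*ⱼ = (sⱼ − β·sign(θⱼ))/(2μ) if θⱼ ≠ 0, and D*ⱼ = max(|sⱼ| − β, 0)·sign(sⱼ)/(2μ) if θⱼ = 0. -/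
/-- The function `x ↦ -s * x + c * x + μ * x ^ 2` grows quadratically from its minimizer. -/
lemma quadratic_growth_of_linear {μ : ℝ} (hμ : 0 < μ) (s c x : ℝ) :
    -s * ((s - c) / (2 * μ)) + c * ((s - c) / (2 * μ)) + μ * ((s - c) / (2 * μ)) ^ 2
        + μ * (x - (s - c) / (2 * μ)) ^ 2
      ≤ -s * x + c * x + μ * x ^ 2 := by
  obtain ⟨y, hy⟩ : ∃ y, y = (s - c) / (2 * μ) := ⟨_, rfl⟩
  rw [← hy]
  have hs : s = c + 2 * μ * y := by rw [hy]; field_simp; ring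
  subst hs
  exact le_of_eq (by ring)

/-- The function `x ↦ -s * x + β * |x| + μ * x ^ 2` grows quadratically from its minimizer, the
rescaled soft thresholding of `s` at level `β`. -/
lemma quadratic_growth_of_soft_threshold {β μ : ℝ} (hβ : 0 ≤ β) (hμ : 0 < μ) (s x : ℝ) {y : ℝ}
    (hy : y = max (|s| - β) 0 * Real.sign s / (2 * μ)) :
    -s * y + β * |y| + μ * y ^ 2 + μ * (x - y) ^ 2 ≤ -s * x + β * |x| + μ * x ^ 2 := by
  have hyμ : 2 * μ * y = max (|s| - β) 0 * Real.sign s := by rw [hy]; field_simp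
  rcases le_total |s| β with h | h
  · have hy0 : y = 0 := by simp [hy, max_eq_right (sub_nonpos.2 h)]
    subst hy0
    have hsx : s * x ≤ β * |x| := by
      calc s * x ≤ |s * x| := le_abs_self _
        _ = |s| * |x| := abs_mul s x
        _ ≤ β * |x| := by gcongr
    simp only [abs_zero]
    linarith
  · rw [max_eq_left (sub_nonneg.2 h)] at hyμ
    have hx₁ := mul_le_mul_of_nonneg_left (le_abs_self x) hβ
    have hx₂ := mul_le_mul_of_nonneg_left (neg_le_abs x) hβ
    rcases lt_trichotomy s 0 with hs | hs | hs
    · rw [Real.sign_of_neg hs, abs_of_neg hs] at hyμ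
      rw [abs_of_neg hs] at h
      have hy0 : y ≤ 0 := by nlinarith
      rw [abs_of_nonpos hy0]
      obtain rfl : s = 2 * μ * y - β := by linarith
      linarith
    · subst hs
      have hy0 : y = 0 := by simp [hy]
      subst hy0
      have := mul_nonneg hβ (abs_nonneg x)
      simp only [abs_zero]
      linarith
    · rw [Real.sign_of_pos hs, abs_of_pos hs] at hyμ
      rw [abs_of_pos hs] at h
      have hy0 : 0 ≤ y := by nlinarith
      rw [abs_of_nonneg hy0]
      obtain rfl : s = 2 * μ * y + β := by linarith
      linarith

open Classical in
/-- Cases one and two of Equation (9) in Proposition 2.2 (up to the positive scalar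
`1/(2μ)`): for a row `θ ≠ 0` with gradient `g`, the penalized row objective
`φ(D) = ⟨g,D⟩ + λ⟨θ,D⟩/‖θ‖₂ + β(Σ_{θⱼ≠0} sign(θⱼ)Dⱼ + Σ_{θⱼ=0}|Dⱼ|) + μ‖D‖₂²`
attains a strict global minimum at the unique point given coordinatewise by
`D*ⱼ = (sⱼ − β·sign(θⱼ))/(2μ)` if `θⱼ ≠ 0`, and
`D*ⱼ = max(|sⱼ| − β, 0)·sign(sⱼ)/(2μ)` if `θⱼ = 0`, where `sⱼ = −gⱼ − λθⱼ/‖θ‖₂`. -/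
theorem row_direction_min_nonzero_row
    (k : ℕ) (hk : 0 < k) (g θ : Fin k → ℝ) (hθ : θ ≠ 0)
    (lam β μ : ℝ) (hlam : 0 ≤ lam) (hβ : 0 ≤ β) (hμ : 0 < μ) :
    let nrm : ℝ := Real.sqrt (∑ j, θ j ^ 2)
    let s : Fin k → ℝ := fun j => -g j - lam * θ j / nrm
    let φ : (Fin k → ℝ) → ℝ := fun D =>
      (∑ j, g j * D j) + lam * (∑ j, θ j * D j) / nrm
        + β * ((∑ j ∈ Finset.univ.filter fun j => θ j ≠ 0, Real.sign (θ j) * D j)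
          + ∑ j ∈ Finset.univ.filter fun j => θ j = 0, |D j|)
        + μ * ∑ j, D j ^ 2
    let Dstar : Fin k → ℝ := fun j =>
      if θ j ≠ 0 then (s j - β * Real.sign (θ j)) / (2 * μ)
      else max (|s j| - β) 0 * Real.sign (s j) / (2 * μ)
    ∀ D : Fin k → ℝ, φ Dstar ≤ φ D ∧ (φ Dstar = φ D → D = Dstar) := by
  intro nrm s φ Dstar D
  have hφ : ∀ E, φ E = ∑ j, (-s j * E j
      + β * (if θ j ≠ 0 then Real.sign (θ j) * E j else |E j|) + μ * E j ^ 2) := by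
    intro E
    have hite : ∀ j, (if θ j ≠ 0 then Real.sign (θ j) * E j else |E j|)
        = (if θ j ≠ 0 then Real.sign (θ j) * E j else 0) + if θ j = 0 then |E j| else 0 := by
      intro j
      by_cases h : θ j = 0 <;> simp [h]
    simp only [φ, s, hite, Finset.sum_filter, Finset.mul_sum, Finset.sum_div, mul_add,
      ← Finset.sum_add_distrib]
    refine Finset.sum_congr rfl fun j _ => ?_
    ring
  have hgrowth : φ Dstar + ∑ j, μ * (D j - Dstar j) ^ 2 ≤ φ D := by
    rw [hφ, hφ, ← Finset.sum_add_distrib]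
    refine Finset.sum_le_sum fun j _ => ?_
    by_cases h : θ j = 0
    · have hD : Dstar j = max (|s j| - β) 0 * Real.sign (s j) / (2 * μ) := by simp [Dstar, h]
      simpa [h] using quadratic_growth_of_soft_threshold hβ hμ (s j) (D j) hD
    · have hD : Dstar j = (s j - β * Real.sign (θ j)) / (2 * μ) := by simp [Dstar, h]
      have := quadratic_growth_of_linear hμ (s j) (β * Real.sign (θ j)) (D j)
      rw [← hD] at this
      simpa [h, mul_assoc] using this
  have hnonneg : ∀ j ∈ Finset.univ, 0 ≤ μ * (D j - Dstar j) ^ 2 := fun j _ => by positivity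
  have hsum := Finset.sum_nonneg hnonneg
  refine ⟨by linarith, fun heq => funext fun j => ?_⟩
  have hzero := (Finset.sum_eq_zero_iff_of_nonneg hnonneg).1 (by linarith) j (Finset.mem_univ j)
  simpa [hμ.ne', sub_eq_zero] using hzero
end

section
/- Let k be a positive natural number, let g ∈ ℝ^k, and let λ, β ≥ 0, μ > 0. Define v ∈ ℝ^k by vⱼ = max(|gⱼ| − β, 0)·sign(−gⱼ), and define ψ : ℝ^k → ℝ by ψ(D) = ⟨g, D⟩ + λ‖D‖₂ + β‖D‖₁ + μ‖D‖₂². Then ψ attains a strict global minimum at the unique point D* given by D* = (max(‖v‖₂ − λ, 0)/(2μ‖v‖₂))·v if v ≠ 0, and D* = 0 if v = 0. -/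
/-- The soft-thresholded vector gives a linear lower bound for `g x + β |x|`. -/
theorem neg_softThreshold_mul_le (a b x : ℝ) (hb : 0 ≤ b) :
    -((max (|a| - b) 0 * Real.sign (-a)) * x) ≤ a * x + b * |x| := by
  have h1 := neg_abs_le x
  have h2 := le_abs_self x
  rcases lt_trichotomy a 0 with ha | rfl | ha
  · rw [abs_of_neg ha, Real.sign_of_pos (neg_pos.2 ha)]
    rcases le_total (-a - b) 0 with h | h
    · rw [max_eq_right h]; nlinarith [abs_nonneg x]
    · rw [max_eq_left h]; nlinarith
  · simp only [neg_zero, Real.sign_zero]; nlinarith [mul_nonneg hb (abs_nonneg x)]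
  · rw [abs_of_pos ha, Real.sign_of_neg (neg_neg_iff_pos.2 ha)]
    rcases le_total (a - b) 0 with h | h
    · rw [max_eq_right h]; nlinarith [abs_nonneg x]
    · rw [max_eq_left h]; nlinarith

/-- The bound `neg_softThreshold_mul_le` is attained at nonnegative multiples of the
soft-thresholded value. -/
theorem softThreshold_mul_eq (a b c : ℝ) (hc : 0 ≤ c) :
    a * (c * (max (|a| - b) 0 * Real.sign (-a)))
      + b * |c * (max (|a| - b) 0 * Real.sign (-a))|
      = -((max (|a| - b) 0 * Real.sign (-a)) * (c * (max (|a| - b) 0 * Real.sign (-a)))) := by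
  rcases le_total (|a| - b) 0 with h | h
  · simp [max_eq_right h]
  · rw [max_eq_left h]
    rcases lt_trichotomy a 0 with ha | rfl | ha
    · rw [abs_of_neg ha] at h ⊢
      rw [Real.sign_of_pos (neg_pos.2 ha), mul_one, abs_of_nonneg (mul_nonneg hc h)]
      ring
    · simp
    · rw [abs_of_pos ha] at h ⊢
      rw [Real.sign_of_neg (neg_neg_iff_pos.2 ha), mul_neg_one, mul_neg, abs_neg,
        abs_of_nonneg (mul_nonneg hc h)]
      ring

/-- Strong convexity bound for `-p + lam d + μ d²` around the shrunken point, where `p`, `d`, `N`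
play the roles of `⟨v, D⟩`, `‖D‖`, `‖v‖`. -/
theorem shrinkage_bound {lam μ N d p : ℝ} (hlam : 0 ≤ lam) (hμ : 0 < μ) (hN : 0 ≤ N)
    (hd : 0 ≤ d) (hp : p ≤ N * d) {c : ℝ} (hc : c = max (N - lam) 0 / (2 * μ * N)) :
    -(c * N ^ 2) + lam * (c * N) + μ * (c ^ 2 * N ^ 2)
      + μ * (d ^ 2 - 2 * c * p + c ^ 2 * N ^ 2) ≤ -p + lam * d + μ * d ^ 2 := by
  rcases le_total (N - lam) 0 with h | h
  · rw [max_eq_right h, zero_div] at hc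
    subst hc
    nlinarith
  · rw [max_eq_left h] at hc
    rcases hN.eq_or_lt with h0 | h0
    · subst h0
      simp only [mul_zero, div_zero] at hc
      subst hc
      nlinarith
    · have hm : 2 * μ * c * N = N - lam := by rw [hc]; field_simp
      have key : 0 ≤ N * (-p + lam * d + 2 * μ * c * p) := by
        have : N * (-p + lam * d + 2 * μ * c * p) = lam * (N * d - p) := by
          linear_combination p * hm
        rw [this]
        exact mul_nonneg hlam (sub_nonneg.2 hp)
      have key' := nonneg_of_mul_nonneg_right key h0
      linear_combination key' + c * N * hm

open Classical in
/-- The third case of Equation (9) in Proposition 2.2 (up to the positive scalar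
`1/(2μ)`): for a zero row with gradient `g`, the penalized row objective
`ψ(D) = ⟨g,D⟩ + λ‖D‖₂ + β‖D‖₁ + μ‖D‖₂²` attains a strict global minimum at
`D* = (max(‖v‖₂ − λ, 0)/(2μ‖v‖₂))·v` if `v ≠ 0`, and `D* = 0` if `v = 0`,
where `vⱼ = max(|gⱼ| − β, 0)·sign(−gⱼ)`. -/
theorem row_direction_min_zero_row
    (k : ℕ) (hk : 0 < k) (g : Fin k → ℝ)
    (lam β μ : ℝ) (hlam : 0 ≤ lam) (hβ : 0 ≤ β) (hμ : 0 < μ) :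
    let v : Fin k → ℝ := fun j => max (|g j| - β) 0 * Real.sign (-g j)
    let ψ : (Fin k → ℝ) → ℝ := fun D =>
      (∑ j, g j * D j) + lam * Real.sqrt (∑ j, D j ^ 2) + β * (∑ j, |D j|)
        + μ * ∑ j, D j ^ 2
    let vnorm : ℝ := Real.sqrt (∑ j, v j ^ 2)
    let Dstar : Fin k → ℝ :=
      if v = 0 then 0 else fun j => max (vnorm - lam) 0 / (2 * μ * vnorm) * v j
    ∀ D : Fin k → ℝ, ψ Dstar ≤ ψ D ∧ (ψ Dstar = ψ D → D = Dstar) := by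
  intro v ψ vnorm Dstar D
  set c : ℝ := max (vnorm - lam) 0 / (2 * μ * vnorm) with hc
  have hN : 0 ≤ vnorm := Real.sqrt_nonneg _
  have hc0 : 0 ≤ c := by positivity
  have hDs : ∀ j, Dstar j = c * v j := by
    intro j
    by_cases hv : v = 0
    · simp [Dstar, hv]
    · simp [Dstar, hv, hc]
  have hN2 : ∑ j, v j ^ 2 = vnorm ^ 2 :=
    (Real.sq_sqrt (Finset.sum_nonneg fun j _ => sq_nonneg _)).symm
  have hd2 : ∑ j, D j ^ 2 = Real.sqrt (∑ j, D j ^ 2) ^ 2 :=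
    (Real.sq_sqrt (Finset.sum_nonneg fun j _ => sq_nonneg _)).symm
  have hs2 : ∑ j, Dstar j ^ 2 = c ^ 2 * vnorm ^ 2 := by
    simp only [hDs, mul_pow, ← Finset.mul_sum, hN2]
  have hs : Real.sqrt (∑ j, Dstar j ^ 2) = c * vnorm := by
    rw [hs2, ← mul_pow, Real.sqrt_sq (mul_nonneg hc0 hN)]
  have hp : ∑ j, v j * D j ≤ vnorm * Real.sqrt (∑ j, D j ^ 2) :=
    Real.sum_mul_le_sqrt_mul_sqrt _ _ _
  have hlow : -(∑ j, v j * D j) ≤ (∑ j, g j * D j) + β * ∑ j, |D j| := by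
    rw [Finset.mul_sum, ← Finset.sum_add_distrib, ← Finset.sum_neg_distrib]
    exact Finset.sum_le_sum fun j _ => neg_softThreshold_mul_le (g j) β (D j) hβ
  have hatt : (∑ j, g j * Dstar j) + β * ∑ j, |Dstar j| = -(c * vnorm ^ 2) := by
    rw [Finset.mul_sum, ← Finset.sum_add_distrib, ← hN2, Finset.mul_sum,
      ← Finset.sum_neg_distrib]
    refine Finset.sum_congr rfl fun j _ => ?_
    rw [hDs]
    refine (softThreshold_mul_eq (g j) β c hc0).trans ?_
    change -(v j * (c * v j)) = _
    ring
  have hdist : ∑ j, (D j - Dstar j) ^ 2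
      = (Real.sqrt (∑ j, D j ^ 2)) ^ 2 - 2 * c * (∑ j, v j * D j) + c ^ 2 * vnorm ^ 2 := by
    rw [← hd2, ← hN2, Finset.mul_sum, Finset.mul_sum, ← Finset.sum_sub_distrib,
      ← Finset.sum_add_distrib]
    refine Finset.sum_congr rfl fun j _ => ?_
    rw [hDs]
    ring
  have hmain : ψ Dstar + μ * ∑ j, (D j - Dstar j) ^ 2 ≤ ψ D := by
    have hb := shrinkage_bound hlam hμ hN (Real.sqrt_nonneg (∑ j, D j ^ 2)) hp hc
    rw [← hdist, ← hd2] at hb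
    simp only [ψ]
    rw [hs, hs2]
    linarith
  have hnonneg : 0 ≤ ∑ j, (D j - Dstar j) ^ 2 := Finset.sum_nonneg fun j _ => sq_nonneg _
  refine ⟨by nlinarith, fun heq => ?_⟩
  have hzero : ∑ j, (D j - Dstar j) ^ 2 = 0 := by nlinarith
  rw [Finset.sum_eq_zero_iff_of_nonneg fun j _ => sq_nonneg _] at hzero
  funext j
  exact sub_eq_zero.1 (pow_eq_zero_iff two_ne_zero |>.1 (hzero j (Finset.mem_univ j)))
end
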